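/- (Generalized Sebestyén theorem.) Let T and B be closed densely defined operators from H to K such that T*∘B (domain {x ∈ dom B : Bx ∈ dom T*}) is selfadjoint, let B₀ denote the restriction of B to dom(T*∘B) (which is densely defined and closable), and let B̄₀ be its closure. Then the following are equivalent: (i) there exists λ ≥ 0 such that dom(T*∘B) ⊆ dom T and ‖Tx‖² ≤ λ·Re⟨Bx, Tx⟩ for all x ∈ dom(T*∘B); (ii) there exists X ∈ L⁺(K) with X∘B̄₀ ⊆ T. Moreover, if (i) holds with constant λ then X can be chosen with ‖X‖ ≤ λ and ker T* ⊆ ker X; conversely (ii) implies (i) with λ = ‖X‖; and in this case B₀*∘X∘B̄₀ = T*∘B̄₀ = B₀*∘T. -/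

import Mathlib

open scoped ComplexOrder
noncomputable section

local notation "⟪" x ", " y "⟫" => @inner ℂ _ _ x y

section Toolkit

/-- Composition of partially defined linear maps:
`pcomp S T` has domain `{x ∈ dom T : T x ∈ dom S}` and maps `x ↦ S (T x)`. -/
def pcomp {R E F G : Type*} [CommRing R] [AddCommGroup E] [Module R E]
    [AddCommGroup F] [Module R F] [AddCommGroup G] [Module R G]
    (S : F →ₗ.[R] G) (T : E →ₗ.[R] F) : E →ₗ.[R] G where
  domain := (S.domain.comap T.toFun).map T.domain.subtype
  toFun := (S.toFun.comp (T.toFun.restrict (p := S.domain.comap T.toFun) (q := S.domain)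
      fun _ hx => hx)).comp
    (Submodule.equivMapOfInjective T.domain.subtype (Submodule.injective_subtype _)
      (S.domain.comap T.toFun)).symm.toLinearMap

/-- A bounded everywhere-defined operator viewed as a `LinearPMap` with domain `⊤`. -/
def ofCLM {E F : Type*} [NormedAddCommGroup E] [NormedAddCommGroup F]
    [NormedSpace ℂ E] [NormedSpace ℂ F] (X : E →L[ℂ] F) : E →ₗ.[ℂ] F :=
  (X : E →ₗ[ℂ] F).toPMap ⊤

variable {H : Type*} [NormedAddCommGroup H] [InnerProductSpace ℂ H] [CompleteSpace H]

/-- `B` is nonnegative selfadjoint: densely defined, `B* = B`, and `⟪Bx, x⟫ ≥ 0` on `dom B`. -/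
def IsNonnegSelfAdjoint (B : H →ₗ.[ℂ] H) : Prop :=
  Dense (B.domain : Set H) ∧ B.adjoint = B ∧ ∀ x : B.domain, 0 ≤ ⟪B x, (x : H)⟫

/-- `C` is a selfadjoint partial operator: densely defined with `C* = C`. -/
def IsSelfAdjointPMap (C : H →ₗ.[ℂ] H) : Prop :=
  Dense (C.domain : Set H) ∧ C.adjoint = C

/-- A quasi-affinity: an injective bounded everywhere-defined operator with dense range. -/
def IsQuasiAffinity (G : H →L[ℂ] H) : Prop :=
  Function.Injective G ∧ DenseRange G

end Toolkit

namespace LinearPMap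

theorem mem_graph_adjoint_iff {E F : Type*} [NormedAddCommGroup E] [InnerProductSpace ℂ E]
    [CompleteSpace E] [NormedAddCommGroup F] [InnerProductSpace ℂ F] {T : E →ₗ.[ℂ] F}
    (hT : Dense (T.domain : Set E)) {y : F} {w : E} :
    (y, w) ∈ T.adjoint.graph ↔ ∀ a b, (a, b) ∈ T.graph → ⟪b, y⟫ = ⟪a, w⟫ := by
  simp [adjoint_graph_eq_graph_adjoint hT, -mem_graph_iff, sub_eq_zero]

theorem mem_graph_pcomp_iff {R E F G : Type*} [CommRing R] [AddCommGroup E] [Module R E]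
    [AddCommGroup F] [Module R F] [AddCommGroup G] [Module R G]
    {S : F →ₗ.[R] G} {T : E →ₗ.[R] F} {x : E} {z : G} :
    (x, z) ∈ (pcomp S T).graph ↔ ∃ y, (x, y) ∈ T.graph ∧ (y, z) ∈ S.graph := by
  have happ (x : T.domain) (hx : T x ∈ S.domain) (h : (x : E) ∈ (pcomp S T).domain) :
      pcomp S T ⟨x, h⟩ = S ⟨T x, hx⟩ := by
    have hsymm : (Submodule.equivMapOfInjective T.domain.subtype
        (Submodule.injective_subtype _) (S.domain.comap T.toFun)).symm ⟨x, h⟩ = ⟨x, hx⟩ := by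
      rw [LinearEquiv.symm_apply_eq]
      rfl
    change S.toFun (T.toFun.restrict _ ((Submodule.equivMapOfInjective T.domain.subtype
        (Submodule.injective_subtype _) (S.domain.comap T.toFun)).symm ⟨x, h⟩)) = _
    rw [hsymm]
    rfl
  constructor
  · intro h
    obtain ⟨⟨_, hd⟩, rfl, rfl⟩ := (mem_graph_iff _).1 h
    obtain ⟨x, hx, rfl⟩ := id hd
    exact ⟨T x, mem_graph _ x, (happ x hx hd).symm ▸ mem_graph S ⟨T x, hx⟩⟩
  · rintro ⟨y, hxy, hyz⟩
    obtain ⟨x, rfl, rfl⟩ := (mem_graph_iff _).1 hxy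
    obtain ⟨y, hy, rfl⟩ := (mem_graph_iff _).1 hyz
    have hx : T x ∈ S.domain := mem_domain_of_mem_graph hyz
    have h : (x : E) ∈ (pcomp S T).domain := ⟨x, hx, rfl⟩
    have hy' : y = ⟨T x, hx⟩ := Subtype.ext hy
    rw [hy', ← happ x hx h]
    exact mem_graph _ ⟨(x : E), h⟩

theorem mem_graph_ofCLM_iff {E F : Type*} [NormedAddCommGroup E] [NormedAddCommGroup F]
    [NormedSpace ℂ E] [NormedSpace ℂ F] {X : E →L[ℂ] F} {x : E} {y : F} :
    (x, y) ∈ (ofCLM X).graph ↔ X x = y := by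
  rw [mem_graph_iff]
  constructor
  · rintro ⟨x, rfl, rfl⟩
    rfl
  · rintro rfl
    exact ⟨⟨x, trivial⟩, rfl, rfl⟩

theorem mem_graph_domRestrict_iff {R E F : Type*} [Ring R] [AddCommGroup E] [Module R E]
    [AddCommGroup F] [Module R F] {f : E →ₗ.[R] F} {p : Submodule R E} {x : E} {y : F} :
    (x, y) ∈ (f.domRestrict p).graph ↔ x ∈ p ∧ (x, y) ∈ f.graph := by
  simp only [mem_graph_iff]
  constructor
  · rintro ⟨x, rfl, rfl⟩
    exact ⟨x.2.1, ⟨x, x.2.2⟩, rfl, (domRestrict_apply rfl).symm⟩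
  · rintro ⟨hx, x, rfl, rfl⟩
    exact ⟨⟨x, hx, x.2⟩, rfl, domRestrict_apply rfl⟩

theorem mem_domain_pcomp_iff {R E F G : Type*} [CommRing R] [AddCommGroup E] [Module R E]
    [AddCommGroup F] [Module R F] [AddCommGroup G] [Module R G]
    {S : F →ₗ.[R] G} {T : E →ₗ.[R] F} {x : E} :
    x ∈ (pcomp S T).domain ↔ ∃ hx : x ∈ T.domain, T ⟨x, hx⟩ ∈ S.domain := by
  constructor
  · rintro ⟨x, hx, rfl⟩
    exact ⟨x.2, hx⟩
  · rintro ⟨hx, h⟩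
    exact ⟨⟨x, hx⟩, h, rfl⟩

end LinearPMap

section PositiveExtension

variable {V K : Type*} [NormedAddCommGroup K] [InnerProductSpace ℂ K] [CompleteSpace K]

theorem exists_isPositive_extension_of_inner_eq
    [SeminormedAddCommGroup V] [InnerProductSpace ℂ V] (b t : V →ₗ[ℂ] K)
    (hinner : ∀ v w : V, ⟪v, w⟫ = ⟪b v, t w⟫) {lam : ℝ} (hlam : 0 ≤ lam)
    (hle : ∀ v, ‖t v‖ ^ 2 ≤ lam * ‖v‖ ^ 2) :
    ∃ X : K →L[ℂ] K, X.IsPositive ∧ ‖X‖ ≤ lam ∧ (∀ v, X (b v) = t v) ∧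
      ∀ y, (∀ v, ⟪t v, y⟫ = 0) → X y = 0 := by
  have hbound (v : V) : ‖t v‖ ≤ √lam * ‖v‖ := by
    refine abs_le_of_sq_le_sq' ?_ (by positivity) |>.2
    rw [mul_pow, Real.sq_sqrt hlam]
    exact hle v
  let e : V →L[ℂ] UniformSpace.Completion V := UniformSpace.Completion.toComplL
  have he : DenseRange e := UniformSpace.Completion.denseRange_coe
  let J : UniformSpace.Completion V →L[ℂ] K := (t.mkContinuous _ hbound).extend e
  have hJ (v : V) : J (e v) = t v :=
    ContinuousLinearMap.extend_eq _ he (UniformSpace.Completion.isUniformInducing_coe V) v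
  have hJnorm : ‖J‖ ≤ √lam := by
    refine J.opNorm_le_bound (Real.sqrt_nonneg _) fun u => ?_
    induction u using UniformSpace.Completion.induction_on with
    | hp => exact isClosed_le (by fun_prop) (by fun_prop)
    | ih v => simpa [UniformSpace.Completion.norm_coe] using (hJ v).symm ▸ hbound v
  have hadj {y : K} {u : UniformSpace.Completion V} (h : ∀ v, ⟪t v, y⟫ = ⟪e v, u⟫) :
      J.adjoint y = u := by
    refine he.eq_of_inner_right ℂ fun v => ?_
    rw [ContinuousLinearMap.adjoint_inner_right, hJ, h]
  refine ⟨J ∘L J.adjoint, ?_, ?_, fun v => ?_, fun y hy => ?_⟩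
  · exact ContinuousLinearMap.isPositive_self_comp_adjoint J
  · calc ‖J ∘L J.adjoint‖ ≤ ‖J‖ * ‖J.adjoint‖ := ContinuousLinearMap.opNorm_comp_le _ _
      _ = ‖J‖ * ‖J‖ := by rw [LinearIsometryEquiv.norm_map]
      _ ≤ √lam * √lam := by gcongr
      _ = lam := Real.mul_self_sqrt hlam
  · rw [ContinuousLinearMap.comp_apply, hadj (u := e v), hJ]
    intro w
    rw [← inner_conj_symm, ← hinner, inner_conj_symm]
    exact (UniformSpace.Completion.inner_coe w v).symm
  · rw [ContinuousLinearMap.comp_apply, hadj (u := 0), map_zero]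
    simpa using hy

/-- Extension of the operator `b v ↦ t v` to a bounded positive operator on the whole space. -/
theorem exists_isPositive_extension [AddCommGroup V] [Module ℂ V] (b t : V →ₗ[ℂ] K)
    (hsymm : ∀ v w, ⟪b v, t w⟫ = ⟪t v, b w⟫) {lam : ℝ} (hlam : 0 ≤ lam)
    (hle : ∀ v, ‖t v‖ ^ 2 ≤ lam * (⟪b v, t v⟫).re) :
    ∃ X : K →L[ℂ] K, X.IsPositive ∧ ‖X‖ ≤ lam ∧ (∀ v, X (b v) = t v) ∧
      ∀ y, (∀ v, ⟪t v, y⟫ = 0) → X y = 0 := by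
  let core : PreInnerProductSpace.Core ℂ V :=
    { inner v w := ⟪b v, t w⟫
      conj_inner_symm v w := by rw [inner_conj_symm, hsymm]
      re_inner_nonneg v := by
        rcases hlam.eq_or_lt with rfl | hpos
        · have : t v = 0 := by simpa using hle v
          simp [this]
        · exact nonneg_of_mul_nonneg_right ((sq_nonneg _).trans (hle v)) hpos
      add_left u v w := by simp
      smul_left v w r := by simp [mul_comm] }
  let : SeminormedAddCommGroup V :=
    InnerProductSpace.Core.toSeminormedAddCommGroup (𝕜 := ℂ)
  let : InnerProductSpace ℂ V := InnerProductSpace.ofCore core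
  refine exists_isPositive_extension_of_inner_eq b t (fun _ _ => rfl) hlam fun v => ?_
  rw [← inner_self_eq_norm_sq (𝕜 := ℂ) v]
  exact hle v

theorem ContinuousLinearMap.IsPositive.norm_apply_sq_le {X : K →L[ℂ] K} (hX : X.IsPositive)
    (y : K) : ‖X y‖ ^ 2 ≤ ‖X‖ * (⟪y, X y⟫).re := by
  have hX₀ : 0 ≤ X := (nonneg_iff_isPositive X).2 hX
  set R := CFC.sqrt X
  have hRR : R * R = X := CFC.sqrt_mul_sqrt_self X
  have hR : IsSelfAdjoint R := (CFC.sqrt_nonneg X).isSelfAdjoint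
  have hXy : X y = R (R y) := by rw [← hRR]; rfl
  have hnorm : ‖X‖ = ‖R‖ ^ 2 := by rw [← hRR, hR.norm_mul_self]
  have hinner : (⟪y, X y⟫).re = ‖R y‖ ^ 2 := by
    rw [hXy, ← hR.isSymmetric.apply_clm, ← inner_self_eq_norm_sq (𝕜 := ℂ)]
    rfl
  rw [hinner, hnorm, hXy, ← mul_pow]
  gcongr
  exact R.le_opNorm _

end PositiveExtension

open LinearPMap

/-- generalized Sebestyén theorem: for closed densely defined `T, B : H → K` with
`T* ∘ B` selfadjoint, and `B₀ = B ↾ dom (T* ∘ B)` (densely defined and closable), the Sebestyén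
inequality `T*T ≤ λ T*B` holds iff `X ∘ B̄₀ ⊆ T` for some `X ∈ L⁺(K)`; with the quantitative
choices `‖X‖ ≤ λ`, `ker T* ⊆ ker X`, and the identities `B₀* ∘ X ∘ B̄₀ = T* ∘ B̄₀ = B₀* ∘ T`. -/
theorem statement6
    {H K : Type*} [NormedAddCommGroup H] [InnerProductSpace ℂ H] [CompleteSpace H]
    [NormedAddCommGroup K] [InnerProductSpace ℂ K] [CompleteSpace K]
    (T B : H →ₗ.[ℂ] K) (hT : T.IsClosed) (hB : B.IsClosed)
    (hTd : Dense (T.domain : Set H)) (hBd : Dense (B.domain : Set H))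
    (hsa : IsSelfAdjointPMap (pcomp T.adjoint B))
    (B₀ : H →ₗ.[ℂ] K) (hB₀ : B₀ = B.domRestrict (pcomp T.adjoint B).domain) :
    -- `B₀` is densely defined and closable
    Dense (B₀.domain : Set H) ∧ B₀.IsClosable ∧
    -- the equivalence (i) ↔ (ii)
    ((∃ lam : ℝ, 0 ≤ lam ∧ (pcomp T.adjoint B).domain ≤ T.domain ∧
        ∀ (x : H) (hxB : x ∈ B.domain), B ⟨x, hxB⟩ ∈ T.adjoint.domain →
          ∀ hxT : x ∈ T.domain,
            ‖T ⟨x, hxT⟩‖ ^ 2 ≤ lam * (⟪B ⟨x, hxB⟩, T ⟨x, hxT⟩⟫).re) ↔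
      (∃ X : K →L[ℂ] K, X.IsPositive ∧ ∃ h : B₀.closure.domain ≤ T.domain,
        ∀ x : B₀.closure.domain, T ⟨(x : H), h x.2⟩ = X (B₀.closure x))) ∧
    -- (i) with constant `lam` gives `X` with `‖X‖ ≤ lam` and `ker T* ⊆ ker X`
    (∀ lam : ℝ, 0 ≤ lam → (pcomp T.adjoint B).domain ≤ T.domain →
      (∀ (x : H) (hxB : x ∈ B.domain), B ⟨x, hxB⟩ ∈ T.adjoint.domain →
        ∀ hxT : x ∈ T.domain,
          ‖T ⟨x, hxT⟩‖ ^ 2 ≤ lam * (⟪B ⟨x, hxB⟩, T ⟨x, hxT⟩⟫).re) →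
      ∃ X : K →L[ℂ] K, X.IsPositive ∧ ‖X‖ ≤ lam ∧
        (∃ h : B₀.closure.domain ≤ T.domain,
          ∀ x : B₀.closure.domain, T ⟨(x : H), h x.2⟩ = X (B₀.closure x)) ∧
        (∀ y : T.adjoint.domain, T.adjoint y = 0 → X (y : K) = 0)) ∧
    -- conversely (ii) gives (i) with `lam = ‖X‖`, together with the identities
    (∀ X : K →L[ℂ] K, X.IsPositive →
      (∃ h : B₀.closure.domain ≤ T.domain,
        ∀ x : B₀.closure.domain, T ⟨(x : H), h x.2⟩ = X (B₀.closure x)) →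
      ((pcomp T.adjoint B).domain ≤ T.domain ∧
        (∀ (x : H) (hxB : x ∈ B.domain), B ⟨x, hxB⟩ ∈ T.adjoint.domain →
          ∀ hxT : x ∈ T.domain,
            ‖T ⟨x, hxT⟩‖ ^ 2 ≤ ‖X‖ * (⟪B ⟨x, hxB⟩, T ⟨x, hxT⟩⟫).re) ∧
        pcomp B₀.adjoint (pcomp (ofCLM X) B₀.closure) = pcomp T.adjoint B₀.closure ∧
        pcomp T.adjoint B₀.closure = pcomp B₀.adjoint T)) := by
  have hBcl : B₀.IsClosable := hB.isClosable.leIsClosable (hB₀ ▸ domRestrict_le)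
  set A := pcomp T.adjoint B with hA
  have hAd : Dense (A.domain : Set H) := hsa.1
  have hAB : A.domain ≤ B.domain := fun x hx => (mem_domain_pcomp_iff.1 hx).1
  have hB₀dom : B₀.domain = A.domain := by
    rw [hB₀]
    exact inf_eq_left.2 hAB
  have hB₀d : Dense (B₀.domain : Set H) := hB₀dom ▸ hAd
  have hB₀B : B₀.closure.graph ≤ B.graph := by
    rw [← hBcl.graph_closure_eq_closure_graph]
    exact Submodule.topologicalClosure_minimal _ (le_graph_of_le (hB₀ ▸ domRestrict_le)) hB
  have hmem {x : H} {y : K} {z : H} (hxy : (x, y) ∈ B.graph) (hyz : (y, z) ∈ T.adjoint.graph) :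
      (x, y) ∈ B₀.graph := by
    rw [hB₀, mem_graph_domRestrict_iff]
    exact ⟨mem_domain_of_mem_graph (mem_graph_pcomp_iff.2 ⟨y, hxy, hyz⟩), hxy⟩
  have hB₀cl : B₀.graph ≤ B₀.closure.graph := le_graph_of_le B₀.le_closure
  have hext {X : K →L[ℂ] K} : (∃ h : B₀.closure.domain ≤ T.domain,
        ∀ x : B₀.closure.domain, T ⟨(x : H), h x.2⟩ = X (B₀.closure x)) ↔
      ∀ x y, (x, y) ∈ B₀.closure.graph → (x, X y) ∈ T.graph := by
    constructor
    · rintro ⟨h, hX⟩ x y hxy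
      obtain ⟨x, rfl, rfl⟩ := (mem_graph_iff _).1 hxy
      rw [← hX x]
      exact mem_graph T ⟨x, h x.2⟩
    · intro h
      have hdom : B₀.closure.domain ≤ T.domain := fun x hx =>
        mem_domain_of_mem_graph (h _ _ (mem_graph _ ⟨x, hx⟩))
      refine ⟨hdom, fun x => ?_⟩
      exact ((image_iff (hdom x.2)).2 (h _ _ (mem_graph _ x))).symm
  have hfwd (lam : ℝ) (hlam : 0 ≤ lam) (hAT : A.domain ≤ T.domain)
      (hle : ∀ (x : H) (hxB : x ∈ B.domain), B ⟨x, hxB⟩ ∈ T.adjoint.domain →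
        ∀ hxT : x ∈ T.domain,
          ‖T ⟨x, hxT⟩‖ ^ 2 ≤ lam * (⟪B ⟨x, hxB⟩, T ⟨x, hxT⟩⟫).re) :
      ∃ X : K →L[ℂ] K, X.IsPositive ∧ ‖X‖ ≤ lam ∧
        (∃ h : B₀.closure.domain ≤ T.domain,
          ∀ x : B₀.closure.domain, T ⟨(x : H), h x.2⟩ = X (B₀.closure x)) ∧
        (∀ y : T.adjoint.domain, T.adjoint y = 0 → X (y : K) = 0) := by
    let b : A.domain →ₗ[ℂ] K := B.toFun ∘ₗ Submodule.inclusion hAB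
    let t : A.domain →ₗ[ℂ] K := T.toFun ∘ₗ Submodule.inclusion hAT
    have hb (v : A.domain) : ((v : H), b v) ∈ B.graph := mem_graph B (Submodule.inclusion hAB v)
    have ht (v : A.domain) : ((v : H), t v) ∈ T.graph := mem_graph T (Submodule.inclusion hAT v)
    have hbA (v : A.domain) : (b v, A v) ∈ T.adjoint.graph := by
      obtain ⟨y, hxy, hyz⟩ := mem_graph_pcomp_iff.1 (mem_graph A v)
      rwa [mem_graph_snd_inj B (hb v) hxy rfl]
    have htb (v w : A.domain) : ⟪t v, b w⟫ = ⟪(v : H), A w⟫ :=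
      (mem_graph_adjoint_iff hTd).1 (hbA w) _ _ (ht v)
    have hAsymm (v w : A.domain) : ⟪A v, (w : H)⟫ = ⟪(v : H), A w⟫ :=
      (mem_graph_adjoint_iff hAd).1 (hsa.2.symm ▸ mem_graph A w) _ _ (mem_graph A v)
    have hsymm (v w : A.domain) : ⟪b v, t w⟫ = ⟪t v, b w⟫ := by
      rw [htb, ← hAsymm, ← inner_conj_symm, htb, inner_conj_symm]
    obtain ⟨X, hX, hXnorm, hXb, hXker⟩ := exists_isPositive_extension b t hsymm hlam
      fun v => hle v (hAB v.2) (mem_domain_of_mem_graph (hbA v)) (hAT v.2)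
    refine ⟨X, hX, hXnorm, hext.2 fun x y hxy => ?_, fun y hy => hXker y fun v => ?_⟩
    · rw [← hBcl.graph_closure_eq_closure_graph] at hxy
      have hcl : IsClosed
          (T.graph.comap (LinearMap.id.prodMap (X : K →ₗ[ℂ] K)) : Set (H × K)) :=
        hT.preimage (continuous_id.prodMap X.continuous)
      refine Submodule.topologicalClosure_minimal _ ?_ hcl hxy
      rintro ⟨x, y⟩ hxy
      rw [hB₀, mem_graph_domRestrict_iff] at hxy
      have : y = b ⟨x, hxy.1⟩ := mem_graph_snd_inj B hxy.2 (hb _) rfl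
      change (x, X y) ∈ T.graph
      rw [this, hXb]
      exact ht ⟨x, hxy.1⟩
    · have := (mem_graph_adjoint_iff hTd).1 (mem_graph T.adjoint y) _ _ (ht v)
      rwa [hy, inner_zero_right] at this
  have hbwd (X : K →L[ℂ] K) (hX : X.IsPositive)
      (hXT : ∀ x y, (x, y) ∈ B₀.closure.graph → (x, X y) ∈ T.graph) :
      A.domain ≤ T.domain ∧
        ∀ (x : H) (hxB : x ∈ B.domain), B ⟨x, hxB⟩ ∈ T.adjoint.domain →
          ∀ hxT : x ∈ T.domain,
            ‖T ⟨x, hxT⟩‖ ^ 2 ≤ ‖X‖ * (⟪B ⟨x, hxB⟩, T ⟨x, hxT⟩⟫).re := by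
    constructor
    · intro x hx
      obtain ⟨y, hxy, hyz⟩ := mem_graph_pcomp_iff.1 (mem_graph A ⟨x, hx⟩)
      exact mem_domain_of_mem_graph (hXT _ _ (hB₀cl (hmem hxy hyz)))
    · intro x hxB hBx hxT
      have hx := hXT _ _ (hB₀cl (hmem (mem_graph B ⟨x, hxB⟩) (mem_graph T.adjoint ⟨_, hBx⟩)))
      rw [← (image_iff hxT).2 hx]
      exact hX.norm_apply_sq_le _
  refine ⟨hB₀d, hBcl, ⟨?_, ?_⟩, hfwd, ?_⟩
  · rintro ⟨lam, hlam, hAT, hle⟩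
    obtain ⟨X, hX, -, hXT, -⟩ := hfwd lam hlam hAT hle
    exact ⟨X, hX, hXT⟩
  · rintro ⟨X, hX, hXT⟩
    exact ⟨‖X‖, norm_nonneg X, hbwd X hX (hext.1 hXT)⟩
  intro X hX h
  have hXT := hext.1 h
  have hTB : pcomp T.adjoint B₀.closure = A := by
    refine eq_of_eq_graph (le_antisymm ?_ ?_) <;> rintro ⟨x, z⟩ hxz <;>
      obtain ⟨y, hxy, hyz⟩ := mem_graph_pcomp_iff.1 hxz <;>
      refine mem_graph_pcomp_iff.2 ⟨y, ?_, hyz⟩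
    · exact hB₀B hxy
    · exact hB₀cl (hmem hxy hyz)
  have hAX : A.graph ≤ (pcomp B₀.adjoint (pcomp (ofCLM X) B₀.closure)).graph := by
    rintro ⟨x, z⟩ hxz
    obtain ⟨y, hxy, hyz⟩ := mem_graph_pcomp_iff.1 hxz
    refine mem_graph_pcomp_iff.2 ⟨X y, mem_graph_pcomp_iff.2
      ⟨y, hB₀cl (hmem hxy hyz), mem_graph_ofCLM_iff.2 rfl⟩,
      (mem_graph_adjoint_iff hB₀d).2 fun a b hab => ?_⟩
    rw [← hX.inner_left_eq_inner_right]
    exact (mem_graph_adjoint_iff hTd).1 hyz _ _ (hXT _ _ (hB₀cl hab))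
  have hXBT : (pcomp B₀.adjoint (pcomp (ofCLM X) B₀.closure)).graph ≤
      (pcomp B₀.adjoint T).graph := by
    rintro ⟨x, z⟩ hxz
    obtain ⟨y, hxy, hyz⟩ := mem_graph_pcomp_iff.1 hxz
    obtain ⟨w, hxw, hwy⟩ := mem_graph_pcomp_iff.1 hxy
    rw [mem_graph_ofCLM_iff] at hwy
    exact mem_graph_pcomp_iff.2 ⟨y, hwy ▸ hXT _ _ hxw, hyz⟩
  have hBTA : (pcomp B₀.adjoint T).graph ≤ A.graph := by
    rintro ⟨x, z⟩ hxz
    obtain ⟨y, hxy, hyz⟩ := mem_graph_pcomp_iff.1 hxz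
    rw [← hsa.2, mem_graph_adjoint_iff hAd]
    intro a c hac
    obtain ⟨b, hab, hbc⟩ := mem_graph_pcomp_iff.1 hac
    rw [← (mem_graph_adjoint_iff hB₀d).1 hyz _ _ (hmem hab hbc), ← inner_conj_symm,
      ← (mem_graph_adjoint_iff hTd).1 hbc _ _ hxy, inner_conj_symm]
  refine ⟨(hbwd X hX hXT).1, (hbwd X hX hXT).2, ?_, ?_⟩
  · rw [hTB]
    exact eq_of_eq_graph (le_antisymm (hXBT.trans hBTA) hAX)
  · rw [hTB]
    exact eq_of_eq_graph (le_antisymm (hAX.trans hXBT) hBTA)
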